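/- Let k be a field of characteristic zero and (R, Δ) a commutative differential k-algebra with R noetherian and dim_k R, |Δ| < |k|. The following are equivalent: (i) R satisfies the Δ-Dixmier-Moeglin equivalence; (ii) for every Δ-primitive ideal P of R, the prime differential core C_spec(P) = {Q ∈ Spec R | (Q : Δ) = P} is locally closed in Spec R; (iii) for every Δ-primitive ideal P of R, the differential core C(P) = {M ∈ Max R | (M : Δ) = P} is locally closed in Max R and its closure in Max R equals {M ∈ Max R | P ⊆ M}. -/

import Mathlib

universe u

section DifferentialAlgebra

variable (k R : Type u) [Field k] [CommRing R] [Algebra k R]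

/-- `I` is a `Δ`-ideal: it is stable under every derivation in `Δ`. -/
def IsDeltaIdeal (Δ : Set (Derivation k R R)) (I : Ideal R) : Prop :=
  ∀ δ ∈ Δ, ∀ x ∈ I, δ x ∈ I

/-- `P` is a `Δ`-prime ideal: a prime ideal which is a `Δ`-ideal. -/
def IsDeltaPrime (Δ : Set (Derivation k R R)) (P : Ideal R) : Prop :=
  P.IsPrime ∧ IsDeltaIdeal k R Δ P

/-- The `Δ`-core of an ideal `J`: the largest `Δ`-ideal contained in `J`. -/
def deltaCore (Δ : Set (Derivation k R R)) (J : Ideal R) : Ideal R :=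
  sSup {I : Ideal R | IsDeltaIdeal k R Δ I ∧ I ≤ J}

/-- `P` is `Δ`-primitive: it is the `Δ`-core of some maximal ideal. -/
def IsDeltaPrimitive (Δ : Set (Derivation k R R)) (P : Ideal R) : Prop :=
  ∃ M : Ideal R, M.IsMaximal ∧ deltaCore k R Δ M = P

/-- `Δ`-spec `R`: the set of `Δ`-prime ideals, topologized as a subspace of `Spec R`. -/
abbrev DeltaSpec (Δ : Set (Derivation k R R)) : Type u :=
  {P : PrimeSpectrum R // IsDeltaIdeal k R Δ P.asIdeal}

/-- `P` is `Δ`-rational: whenever `a, b ∈ R` with `b ∉ P` are such that the class of `a/b` in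
`Frac(R/P)` is killed by all the induced derivations, that class is algebraic over `k`. -/
def IsDeltaRational (Δ : Set (Derivation k R R)) (P : Ideal R) (hP : P.IsPrime) : Prop :=
  haveI := hP
  ∀ a b : R, b ∉ P → (∀ δ ∈ Δ, δ a * b - a * δ b ∈ P) →
    IsAlgebraic k
      (algebraMap (R ⧸ P) (FractionRing (R ⧸ P)) (Ideal.Quotient.mk P a) /
       algebraMap (R ⧸ P) (FractionRing (R ⧸ P)) (Ideal.Quotient.mk P b))

/-- `P` is `κ`-separable in `Δ`-spec `R`: there is a set `Λ`, of cardinality `< κ`, of `Δ`-prime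
ideals properly containing `P`, such that every `Δ`-prime ideal properly containing `P` contains
a member of `Λ`. -/
def DeltaSeparable (Δ : Set (Derivation k R R)) (κ : Cardinal.{u}) (P : Ideal R) : Prop :=
  ∃ Λ : Set (Ideal R), (∀ Q ∈ Λ, IsDeltaPrime k R Δ Q ∧ P < Q) ∧
    Cardinal.mk Λ < κ ∧
    ∀ Q : Ideal R, IsDeltaPrime k R Δ Q → P < Q → ∃ Q' ∈ Λ, Q' ≤ Q

/-- `R` satisfies the `Δ`-Dixmier–Moeglin equivalence: for every `Δ`-prime ideal `P`, the
conditions "`{P}` is locally closed in `Δ`-spec `R`", "`P` is `Δ`-primitive", and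
"`P` is `Δ`-rational" are equivalent. -/
def DeltaDME (Δ : Set (Derivation k R R)) : Prop :=
  ∀ (P : PrimeSpectrum R) (hP : IsDeltaIdeal k R Δ P.asIdeal),
    (IsLocallyClosed ({⟨P, hP⟩} : Set (DeltaSpec k R Δ)) ↔ IsDeltaPrimitive k R Δ P.asIdeal) ∧
    (IsDeltaPrimitive k R Δ P.asIdeal ↔ IsDeltaRational k R Δ P.asIdeal P.isPrime)

end DifferentialAlgebra


section DeltaIdeals

variable {k R : Type u} [Field k] [CommRing R] [Algebra k R]
  {Δ : Set (Derivation k R R)}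

lemma deltaCore_le (J : Ideal R) : deltaCore k R Δ J ≤ J :=
  sSup_le fun _ hI => hI.2

lemma IsDeltaIdeal.le_deltaCore {I J : Ideal R} (hI : IsDeltaIdeal k R Δ I) (h : I ≤ J) :
    I ≤ deltaCore k R Δ J :=
  le_sSup ⟨hI, h⟩

lemma isDeltaIdeal_deltaCore (J : Ideal R) : IsDeltaIdeal k R Δ (deltaCore k R Δ J) := by
  intro δ hδ x hx
  let T : Ideal R :=
    { carrier := {y | y ∈ deltaCore k R Δ J ∧ δ y ∈ deltaCore k R Δ J}
      add_mem' := fun ha hb => ⟨add_mem ha.1 hb.1, by rw [map_add]; exact add_mem ha.2 hb.2⟩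
      zero_mem' := ⟨zero_mem _, by rw [map_zero]; exact zero_mem _⟩
      smul_mem' := fun c y hy => by
        refine ⟨Ideal.mul_mem_left _ c hy.1, ?_⟩
        rw [smul_eq_mul, Derivation.leibniz]
        exact add_mem (Ideal.mul_mem_left _ c hy.2) (Ideal.mul_mem_right _ _ hy.1) }
  have hT : deltaCore k R Δ J ≤ T :=
    sSup_le fun I hI y hy => ⟨hI.1.le_deltaCore hI.2 hy, hI.1.le_deltaCore hI.2 (hI.1 δ hδ y hy)⟩
  exact (hT hx).2

lemma IsDeltaIdeal.deltaCore_eq {I : Ideal R} (hI : IsDeltaIdeal k R Δ I) :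
    deltaCore k R Δ I = I :=
  le_antisymm (deltaCore_le I) (hI.le_deltaCore le_rfl)

/-- Over a minimal prime `Q` of `I`, every element of `Q` is nilpotent modulo `I` up to a
multiplier outside `Q`. -/
lemma exists_mul_pow_mem_of_mem_minimalPrimes {I Q : Ideal R} (hQ : Q ∈ I.minimalPrimes)
    {x : R} (hx : x ∈ Q) : ∃ s ∉ Q, ∃ n : ℕ, s * x ^ n ∈ I := by
  have hp : Q.IsPrime := hQ.1.1
  by_contra! h
  have hdisj : Disjoint (I : Set R) (Q.primeCompl ⊔ Submonoid.powers x : Submonoid R) := by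
    rw [Set.disjoint_left]
    intro y hy hy'
    obtain ⟨s, hs, _, ⟨n, rfl⟩, rfl⟩ := Submonoid.mem_sup.1 hy'
    exact h s hs n hy
  obtain ⟨p, hpp, hIp, hpd⟩ := Ideal.exists_le_prime_disjoint I _ hdisj
  rw [Set.disjoint_left] at hpd
  have hpQ : p ≤ Q := fun y hy => by
    by_contra hyQ
    exact hpd hy (Submonoid.mem_sup_left hyQ)
  exact hpd (hQ.2 ⟨hpp, hIp⟩ hpQ hx)
    (Submonoid.mem_sup_right (Submonoid.mem_powers x))

lemma IsDeltaIdeal.of_mem_minimalPrimes [CharZero k] {I Q : Ideal R}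
    (hI : IsDeltaIdeal k R Δ I) (hQ : Q ∈ I.minimalPrimes) : IsDeltaIdeal k R Δ Q := by
  intro δ hδ x hx
  have hp : Q.IsPrime := hQ.1.1
  by_contra hδx
  have key : ∀ n : ℕ, ∀ s ∉ Q, s * x ^ n ∉ I := by
    intro n
    induction n with
    | zero => exact fun s hs h => hs (hQ.1.2 (by simpa using h))
    | succ n ih =>
      intro s hs h
      refine ih (s ^ 2 * δ x) (hp.mul_notMem (fun h => hs (hp.mem_of_pow_mem _ h)) hδx) ?_
      have h1 : s * δ (s * x ^ (n + 1)) - δ s * (s * x ^ (n + 1)) ∈ I :=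
        sub_mem (Ideal.mul_mem_left _ _ (hI δ hδ _ h)) (Ideal.mul_mem_left _ _ h)
      have h2 : s * δ (s * x ^ (n + 1)) - δ s * (s * x ^ (n + 1)) =
          algebraMap k R (n + 1) * (s ^ 2 * δ x * x ^ n) := by
        simp only [Derivation.leibniz, Derivation.leibniz_pow, smul_eq_mul, nsmul_eq_mul,
          map_add, map_natCast, map_one]
        push_cast
        ring
      have h3 : s ^ 2 * δ x * x ^ n =
          algebraMap k R (n + 1)⁻¹ * (algebraMap k R (n + 1) * (s ^ 2 * δ x * x ^ n)) := by
        rw [← mul_assoc, ← map_mul, inv_mul_cancel₀ (Nat.cast_add_one_ne_zero n), map_one, one_mul]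
      rw [h3, ← h2]
      exact Ideal.mul_mem_left _ _ h1
  obtain ⟨s, hs, n, hn⟩ := exists_mul_pow_mem_of_mem_minimalPrimes hQ hx
  exact key n s hs hn

lemma isPrime_deltaCore [CharZero k] {J : Ideal R} (hJ : J.IsPrime) :
    (deltaCore k R Δ J).IsPrime := by
  obtain ⟨Q, hQ, hQJ⟩ := Ideal.exists_minimalPrimes_le (deltaCore_le (Δ := Δ) J)
  have h : Q ≤ deltaCore k R Δ J :=
    ((isDeltaIdeal_deltaCore J).of_mem_minimalPrimes hQ).le_deltaCore hQJ
  rw [← le_antisymm h hQ.1.2]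
  exact hQ.1.1

end DeltaIdeals

section Cardinality

open Cardinal

lemma isAlgebraic_of_rank_lt {k L : Type u} [Field k] [Field L] [Algebra k L]
    (h : Module.rank k L < #k) (x : L) : IsAlgebraic k x := by
  by_contra hx
  exact (Transcendental.linearIndependent_sub_inv (F := k) hx).cardinal_le_rank.not_gt h

variable {k R : Type u} [Field k] [CommRing R] [Algebra k R]

lemma isAlgebraic_quotient_of_isMaximal (hrank : Module.rank k R < #k) (M : Ideal R)
    [M.IsMaximal] (x : R ⧸ M) : IsAlgebraic k x := by
  let _ := Ideal.Quotient.field M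
  refine isAlgebraic_of_rank_lt (lt_of_le_of_lt ?_ hrank) x
  exact LinearMap.rank_le_of_surjective (Ideal.Quotient.mkₐ k M).toLinearMap
    (Ideal.Quotient.mkₐ_surjective k M)

/-- Localizing `R` at the submonoid generated by `S` raises the dimension to at most
`max ℵ₀ (max (dim R) #S)`. -/
lemma rank_localization_le {B : Type u} [CommRing B] [Algebra k B] [Algebra R B]
    [IsScalarTower k R B] (S : Set R) [IsLocalization (Submonoid.closure S) B] :
    Module.rank k B ≤ max ℵ₀ (max (Module.rank k R) #S) := by
  let b := Module.Basis.ofVectorSpace k R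
  let ι := Module.Basis.ofVectorSpaceIndex k R
  have hι : #ι = Module.rank k R := b.mk_eq_rank''
  let g : ι × List ↥S → B := fun p => algebraMap R B (b p.1) *
    (p.2.map fun s : ↥S => IsLocalization.mk' B (1 : R)
      (⟨s, Submonoid.subset_closure s.2⟩ : Submonoid.closure S)).prod
  have hspan : Submodule.span k (Set.range g) = ⊤ := by
    rw [eq_top_iff]
    rintro z -
    obtain ⟨r, s, rfl⟩ := IsLocalization.exists_mk'_eq (Submonoid.closure S) z
    obtain ⟨l, hl, hls⟩ := Submonoid.exists_list_of_mem_closure s.2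
    let l' : List ↥S := l.attach.map fun y => ⟨y.1, hl y.1 y.2⟩
    have hinv : ∀ m : List ↥S, algebraMap R B (m.map Subtype.val).prod *
        (m.map fun s : ↥S => IsLocalization.mk' B (1 : R)
          (⟨s, Submonoid.subset_closure s.2⟩ : Submonoid.closure S)).prod = 1 := by
      intro m
      induction m with
      | nil => simp
      | cons a m ih =>
        simp only [List.map_cons, List.prod_cons, map_mul]
        rw [mul_mul_mul_comm, ih, mul_one]
        rw [mul_comm]
        exact (IsLocalization.mk'_spec B (1 : R)
          (⟨a, Submonoid.subset_closure a.2⟩ : Submonoid.closure S)).trans (map_one _)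
    have hl' : (l'.map Subtype.val).prod = (s : R) := by
      rw [← hls]; congr 1; simp [l', List.map_map, Function.comp_def]
    have h1 := hinv l'
    rw [hl'] at h1
    have h2 : IsLocalization.mk' B r s = algebraMap R B r *
        (l'.map fun s : ↥S => IsLocalization.mk' B (1 : R)
          (⟨s, Submonoid.subset_closure s.2⟩ : Submonoid.closure S)).prod := by
      rw [IsLocalization.mk'_eq_iff_eq_mul, mul_assoc, mul_comm _ (algebraMap R B s), h1, mul_one]
    rw [h2, ← b.linearCombination_repr r, Finsupp.linearCombination_apply, Finsupp.sum, map_sum,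
      Finset.sum_mul]
    refine sum_mem fun i _ => ?_
    rw [Algebra.smul_def, map_mul, ← IsScalarTower.algebraMap_apply, mul_assoc, ← Algebra.smul_def]
    exact Submodule.smul_mem _ _ (Submodule.subset_span ⟨(i, l'), rfl⟩)
  rw [← rank_top, ← hspan]
  refine (rank_span_le _).trans (mk_range_le.trans ?_)
  rw [mk_prod, lift_id, lift_id, hι]
  refine (mul_le_mul' le_rfl (mk_list_le_max S)).trans ?_
  refine (mul_le_max _ _).trans ?_
  simp only [max_le_iff]
  refine ⟨⟨?_, ?_, ?_⟩, ?_⟩ <;> simp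

/-- A prime ideal is contained in a maximal ideal avoiding any given small set of elements outside
the prime. -/
lemma exists_isMaximal_disjoint [CharZero k] (hrank : Module.rank k R < #k) (P : Ideal R)
    [hP : P.IsPrime] (S : Set R) (hS : #S < #k) (hSP : ∀ s ∈ S, s ∉ P) :
    ∃ M : Ideal R, M.IsMaximal ∧ P ≤ M ∧ ∀ s ∈ S, s ∉ M := by
  have hinf : ℵ₀ ≤ #k := by
    have : Infinite k := Infinite.of_injective _ (Nat.cast_injective (R := k))
    exact aleph0_le_mk k
  rcases hinf.eq_or_lt with hk | hk
  · rw [← hk] at hrank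
    have : Module.Finite k R := Module.rank_lt_aleph0_iff.1 hrank
    have : IsArtinianRing R := IsArtinianRing.of_finite k R
    exact ⟨P, inferInstance, le_rfl, hSP⟩
  · let B := Localization (Submonoid.closure S)
    have hrB : Module.rank k B < #k :=
      (rank_localization_le (k := k) (R := R) (B := B) S).trans_lt (by simp [hk, hrank, hS])
    have hcl : Submonoid.closure S ≤ P.primeCompl := Submonoid.closure_le.2 hSP
    have hPB : P.map (algebraMap R B) ≠ ⊤ :=
      (IsLocalization.isPrime_of_isPrime_disjoint (Submonoid.closure S) B P hP
        (Set.disjoint_left.2 fun x hx hxP => hcl hx hxP)).ne_top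
    obtain ⟨N, hN, hPN⟩ := Ideal.exists_le_maximal _ hPB
    let _ := Ideal.Quotient.field N
    have halg : ∀ z : B ⧸ N, IsAlgebraic k z := isAlgebraic_quotient_of_isMaximal hrB N
    have : Algebra.IsAlgebraic k (B ⧸ N) := ⟨halg⟩
    let f : R →ₐ[k] B ⧸ N := (Ideal.Quotient.mkₐ k N).comp (IsScalarTower.toAlgHom k R B)
    have hf : ∀ r, f r = 0 ↔ algebraMap R B r ∈ N := fun r => Ideal.Quotient.eq_zero_iff_mem
    have hfield : IsField f.range := Subalgebra.isField_of_algebraic f.range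
    refine ⟨RingHom.ker f, ?_, fun x hx => ?_, fun s hs hsN => ?_⟩
    · refine Ideal.Quotient.maximal_of_isField _ ?_
      exact (Ideal.quotientKerEquivRange f).toMulEquiv.isField hfield
    · exact (hf x).2 (hPN (Ideal.mem_map_of_mem _ hx))
    · refine hN.ne_top (Ideal.eq_top_of_isUnit_mem _ ((hf s).1 hsN) ?_)
      exact IsLocalization.map_units B (⟨s, Submonoid.subset_closure hs⟩ : Submonoid.closure S)

end Cardinality

section FractionField

open Polynomial
open scoped TensorProduct

variable {k R K : Type u} [Field k] [CommRing R] [Algebra k R] [Field K] [Algebra k K]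

/-- A derivation of a domain extends to its fraction field. -/
lemma Derivation.exists_extend_isFractionRing {A : Type u} [CommRing A] [Algebra k A]
    [Algebra A K] [IsScalarTower k A K] [IsFractionRing A K] (d : Derivation k A A) :
    ∃ D : Derivation k K K, ∀ a, D (algebraMap A K a) = algebraMap A K (d a) := by
  have : Algebra.FormallyEtale A K := .of_isLocalization (nonZeroDivisors A)
  let d' : Derivation k A K := (Algebra.linearMap A K).compDer d
  let e := KaehlerDifferential.tensorKaehlerEquivOfFormallyEtale k A K
  let g : KaehlerDifferential k K →ₗ[K] K :=
    (d'.liftKaehlerDifferential.liftBaseChange K).comp e.symm.toLinearMap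
  refine ⟨g.compDer (KaehlerDifferential.D k K), fun a => ?_⟩
  have h := KaehlerDifferential.tensorKaehlerEquivOfFormallyEtale_symm_D_algebraMap k A K a
  have hg : g (KaehlerDifferential.D k K (algebraMap A K a)) =
      d'.liftKaehlerDifferential.liftBaseChange K (1 ⊗ₜ KaehlerDifferential.D k A a) :=
    congrArg (d'.liftKaehlerDifferential.liftBaseChange K) h
  refine hg.trans ?_
  simp [d']

/-- A derivation preserving a prime ideal induces one on the residue field of that prime. -/
lemma exists_derivation_fractionRing_quotient (P : Ideal R) [P.IsPrime] (δ : Derivation k R R)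
    (h : ∀ x ∈ P, δ x ∈ P) : ∃ D : Derivation k (FractionRing (R ⧸ P)) (FractionRing (R ⧸ P)),
      ∀ a : R, D (algebraMap R _ a) = algebraMap R _ (δ a) := by
  have h' : ∀ x, Ideal.Quotient.mkₐ k P x = 0 → Ideal.Quotient.mkₐ k P (δ x) = 0 := fun x hx =>
    Ideal.Quotient.eq_zero_iff_mem.2 (h x (Ideal.Quotient.eq_zero_iff_mem.1 hx))
  obtain ⟨D, hD⟩ := Derivation.exists_extend_isFractionRing (K := FractionRing (R ⧸ P))
    (Derivation.liftOfSurjective (Ideal.Quotient.mkₐ_surjective k P) h')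
  refine ⟨D, fun a => ?_⟩
  have := hD (Ideal.Quotient.mkₐ k P a)
  rwa [Derivation.liftOfSurjective_apply] at this

/-- The subfield of elements killed by a set of derivations. -/
def derivationConstants (𝒟 : Set (Derivation k K K)) : IntermediateField k K where
  carrier := {z | ∀ D ∈ 𝒟, D z = 0}
  mul_mem' ha hb D hD := by simp [ha D hD, hb D hD]
  add_mem' ha hb D hD := by simp [ha D hD, hb D hD]
  algebraMap_mem' r D _ := by simp
  inv_mem' a ha D hD := by simp [Derivation.leibniz_inv, ha D hD]

lemma mem_derivationConstants {𝒟 : Set (Derivation k K K)} {z : K} :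
    z ∈ derivationConstants 𝒟 ↔ ∀ D ∈ 𝒟, D z = 0 := Iff.rfl

/-- The homogenization of the polynomial `p`, evaluated at `(s, r)`. -/
noncomputable def homogenizedEval (p : k[X]) (s r : R) : R :=
  ∑ i ∈ Finset.range (p.natDegree + 1), algebraMap k R (p.coeff i) * (s ^ i * r ^ (p.natDegree - i))

lemma map_homogenizedEval {F : Type*} [CommRing F] [Algebra k F] (ψ : R →ₐ[k] F) (p : k[X])
    {s r : R} {c : F} (hc : ψ r * c = ψ s) :
    ψ (homogenizedEval p s r) = ψ r ^ p.natDegree * aeval c p := by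
  rw [homogenizedEval, map_sum, aeval_eq_sum_range, Finset.mul_sum]
  refine Finset.sum_congr rfl fun i hi => ?_
  have hi' : i ≤ p.natDegree := Nat.lt_succ_iff.1 (Finset.mem_range.1 hi)
  rw [map_mul, map_mul, map_pow, map_pow, ← hc, AlgHom.commutes, Algebra.smul_def]
  rw [show ψ r ^ p.natDegree = ψ r ^ (p.natDegree - i) * ψ r ^ i by
    rw [← pow_add, Nat.sub_add_cancel hi']]
  ring

end FractionField

/-- `K` is a residue field of the prime `Δ`-ideal `P`, and `E` extends the derivations in `Δ`
to `K`. -/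
structure IsDeltaResidueField {k R : Type u} (K : Type u) [Field k] [CommRing R] [Algebra k R]
    [Field K] [Algebra k K] [Algebra R K] (Δ : Set (Derivation k R R)) (P : Ideal R)
    (E : Derivation k R R → Derivation k K K) : Prop where
  algebraMap_eq_zero : ∀ x, algebraMap R K x = 0 ↔ x ∈ P
  exists_mul_eq : ∀ z : K, ∃ a b : R, b ∉ P ∧ z * algebraMap R K b = algebraMap R K a
  extends_derivation : ∀ δ ∈ Δ, ∀ a, E δ (algebraMap R K a) = algebraMap R K (δ a)

lemma exists_isDeltaResidueField {k R : Type u} [Field k] [CommRing R] [Algebra k R]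
    {Δ : Set (Derivation k R R)} {P : Ideal R} [P.IsPrime] (hP : IsDeltaIdeal k R Δ P) :
    ∃ E, IsDeltaResidueField (FractionRing (R ⧸ P)) Δ P E := by
  classical
  choose! E hE using fun (δ : Derivation k R R) (h : δ ∈ Δ) =>
    exists_derivation_fractionRing_quotient P δ (hP δ h)
  have h0 : ∀ x, algebraMap R (FractionRing (R ⧸ P)) x = 0 ↔ x ∈ P := fun x => by
    rw [IsScalarTower.algebraMap_apply R (R ⧸ P), IsFractionRing.to_map_eq_zero_iff]
    exact Ideal.Quotient.eq_zero_iff_mem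
  refine ⟨E, h0, fun z => ?_, hE⟩
  obtain ⟨a, b, hb, rfl⟩ := IsFractionRing.div_surjective (A := R ⧸ P) z
  obtain ⟨a, rfl⟩ := Ideal.Quotient.mk_surjective a
  obtain ⟨b, rfl⟩ := Ideal.Quotient.mk_surjective b
  have hbP : b ∉ P := fun h =>
    nonZeroDivisors.ne_zero hb (Ideal.Quotient.eq_zero_iff_mem.2 h)
  exact ⟨a, b, hbP, div_mul_cancel₀ _ (mt (h0 b).1 hbP)⟩

namespace IsDeltaResidueField

open Polynomial

variable {k R K : Type u} [Field k] [CommRing R] [Algebra k R] [Field K] [Algebra k K]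
  [Algebra R K] {Δ : Set (Derivation k R R)} {P : Ideal R}
  {E : Derivation k R R → Derivation k K K}

lemma algebraMap_eq_iff (h : IsDeltaResidueField K Δ P E) {x y : R} :
    algebraMap R K x = algebraMap R K y ↔ x - y ∈ P := by
  rw [← h.algebraMap_eq_zero, map_sub, sub_eq_zero]

lemma mem_constants_iff (h : IsDeltaResidueField K Δ P E) {z : K} {a b : R} (hb : b ∉ P)
    (hz : z * algebraMap R K b = algebraMap R K a) :
    z ∈ derivationConstants (E '' Δ) ↔ ∀ δ ∈ Δ, δ a * b - a * δ b ∈ P := by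
  have hb' : algebraMap R K b ≠ 0 := mt (h.algebraMap_eq_zero b).1 hb
  rw [mem_derivationConstants, Set.forall_mem_image]
  refine forall₂_congr fun δ hδ => ?_
  have h1 := congrArg (E δ) hz
  rw [Derivation.leibniz, h.extends_derivation δ hδ, h.extends_derivation δ hδ, smul_eq_mul,
    smul_eq_mul] at h1
  rw [← h.algebraMap_eq_zero, map_sub, map_mul, map_mul, ← h1, ← hz]
  rw [show (z * algebraMap R K (δ b) + algebraMap R K b * E δ z) * algebraMap R K b
    - z * algebraMap R K b * algebraMap R K (δ b) = algebraMap R K b ^ 2 * E δ z by ring]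
  simp [hb']

/-- A constant of the residue field of the `Δ`-core of `M` is regular at `M`. -/
lemma exists_denominator {M : Ideal R} (h : IsDeltaResidueField K Δ P E)
    (hPM : deltaCore k R Δ M = P) {z : K} (hz : z ∈ derivationConstants (E '' Δ)) :
    ∃ r ∉ M, ∃ s, z * algebraMap R K r = algebraMap R K s := by
  by_contra! hcon
  let J : Ideal R :=
    { carrier := {r | ∃ s, z * algebraMap R K r = algebraMap R K s}
      add_mem' := by
        rintro a b ⟨s, hs⟩ ⟨t, ht⟩
        exact ⟨s + t, by rw [map_add, map_add, mul_add, hs, ht]⟩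
      zero_mem' := ⟨0, by simp⟩
      smul_mem' := by
        rintro c a ⟨s, hs⟩
        exact ⟨c * s, by rw [smul_eq_mul, map_mul, map_mul, mul_left_comm, hs]⟩ }
  have hJ : IsDeltaIdeal k R Δ J := by
    rintro δ hδ a ⟨s, hs⟩
    refine ⟨δ s, ?_⟩
    rw [← h.extends_derivation δ hδ, ← h.extends_derivation δ hδ, ← hs, Derivation.leibniz,
      mem_derivationConstants.1 hz _ ⟨δ, hδ, rfl⟩, smul_zero, add_zero, smul_eq_mul]
  have hJM : J ≤ M := by
    rintro r ⟨s, hs⟩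
    by_contra hr
    exact hcon r hr s hs
  obtain ⟨a, b, hb, hab⟩ := h.exists_mul_eq z
  exact hb (hPM ▸ hJ.le_deltaCore hJM ⟨a, hab⟩)

lemma isAlgebraic_of_mem_constants [IsScalarTower k R K] {M : Ideal R} [M.IsMaximal]
    (h : IsDeltaResidueField K Δ P E) (hM : ∀ x : R ⧸ M, IsAlgebraic k x)
    (hPM : deltaCore k R Δ M = P) {z : K} (hz : z ∈ derivationConstants (E '' Δ)) :
    IsAlgebraic k z := by
  obtain ⟨r, hr, s, hs⟩ := h.exists_denominator hPM hz
  let _ := Ideal.Quotient.field M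
  have hr' : Ideal.Quotient.mkₐ k M r ≠ 0 := fun h0 => hr (Ideal.Quotient.eq_zero_iff_mem.1 h0)
  obtain ⟨p, hp, hpz⟩ := hM (Ideal.Quotient.mkₐ k M s / Ideal.Quotient.mkₐ k M r)
  refine ⟨p, hp, ?_⟩
  set x := homogenizedEval p s r with hx
  have hxM : x ∈ M := by
    refine Ideal.Quotient.eq_zero_iff_mem.1 ?_
    have := map_homogenizedEval (Ideal.Quotient.mkₐ k M) p
      (mul_div_cancel₀ (Ideal.Quotient.mkₐ k M s) hr')
    rw [hpz, mul_zero] at this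
    exact this
  have hxK : algebraMap R K x = algebraMap R K (r ^ p.natDegree) * aeval z p := by
    rw [map_pow]
    exact map_homogenizedEval (IsScalarTower.toAlgHom k R K) p ((mul_comm _ _).trans hs)
  have hrM : r ^ p.natDegree ∉ M := fun h' => hr (Ideal.IsPrime.mem_of_pow_mem inferInstance _ h')
  by_contra hne
  have hconst : (aeval z p)⁻¹ ∈ derivationConstants (E '' Δ) :=
    inv_mem (by
      rw [aeval_eq_sum_range]
      exact sum_mem fun i _ => IntermediateField.smul_mem _ (pow_mem hz i))
  obtain ⟨t, ht, u, hu⟩ := h.exists_denominator hPM hconst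
  have htu : t * r ^ p.natDegree * 1 - u * x ∈ P := by
    rw [← h.algebraMap_eq_iff, map_mul, map_mul, map_mul, hxK, ← hu, map_one]
    field_simp
  have hP : P ≤ M := hPM ▸ deltaCore_le M
  have : t * r ^ p.natDegree ∈ M := by
    have h1 := add_mem (hP htu) (Ideal.mul_mem_left M u hxM)
    simpa using h1
  exact (Ideal.IsPrime.mul_notMem inferInstance ht hrM) this

end IsDeltaResidueField

/-- The coordinatewise iterated derivatives of a family of elements of `R`. -/
inductive IsIteratedDerivative {k R ι : Type*} [Field k] [CommRing R] [Algebra k R]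
    (Δ : Set (Derivation k R R)) (e : ι → R) : (ι → R) → Prop
  | refl : IsIteratedDerivative Δ e e
  | step (δ : Derivation k R R) (hδ : δ ∈ Δ) (w : ι → R) (hw : IsIteratedDerivative Δ e w) :
      IsIteratedDerivative Δ e fun j => δ (w j)

namespace IsDeltaResidueField

open Polynomial

variable {k R K : Type u} [Field k] [CommRing R] [Algebra k R] [Field K] [Algebra k K]
  [Algebra R K] {Δ : Set (Derivation k R R)} {P : Ideal R}
  {E : Derivation k R R → Derivation k K K}

/-- If a finite family is linearly independent over the constants, then the vectors of its iterated
derivatives admit no nontrivial linear relation. -/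
lemma eq_zero_of_forall_isIteratedDerivative (h : IsDeltaResidueField K Δ P E)
    {ι : Type*} [Fintype ι] {e : ι → R}
    (he : LinearIndependent (derivationConstants (E '' Δ)) fun j => algebraMap R K (e j))
    (v : ι → K) (hv : ∀ w, IsIteratedDerivative Δ e w → ∑ j, v j * algebraMap R K (w j) = 0) :
    v = 0 := by
  classical
  induction hn : (Finset.univ.filter fun j => v j ≠ 0).card using Nat.strong_induction_on
    generalizing v with
  | _ n ih =>
  by_contra hne
  obtain ⟨i, hi⟩ := Function.ne_iff.1 hne
  rw [Pi.zero_apply] at hi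
  let u : ι → K := fun j => (v i)⁻¹ * v j
  have hui : u i = 1 := inv_mul_cancel₀ hi
  have hu : ∀ w, IsIteratedDerivative Δ e w → ∑ j, u j * algebraMap R K (w j) = 0 := by
    intro w hw
    simp only [u, mul_assoc, ← Finset.mul_sum, hv w hw, mul_zero]
  have hconst : ∀ j, u j ∈ derivationConstants (E '' Δ) := by
    rintro j _ ⟨δ, hδ, rfl⟩
    refine congrFun (ih _ ?_ (fun j => E δ (u j)) (fun w hw => ?_) rfl) j
    · rw [← hn]
      refine Finset.card_lt_card (Finset.ssubset_iff_subset_ne.2 ⟨fun j hj => ?_, fun heq => ?_⟩)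
      · rw [Finset.mem_filter_univ] at hj ⊢
        intro h0
        simp [u, h0] at hj
      · have : i ∈ Finset.univ.filter fun j => v j ≠ 0 := by simpa using hi
        rw [← heq, Finset.mem_filter_univ, hui] at this
        exact this (E δ).map_one_eq_zero
    · have h1 := congrArg (E δ) (hu w hw)
      have h2 := hu _ (.step δ hδ w hw)
      simp only [map_sum, Derivation.leibniz, h.extends_derivation δ hδ, smul_eq_mul, map_zero,
        Finset.sum_add_distrib, h2, zero_add] at h1
      simpa only [mul_comm] using h1
  have h0 := Fintype.linearIndependent_iff.1 he (fun j => ⟨u j, hconst j⟩)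
    (by simpa only [IntermediateField.smul_def, smul_eq_mul] using hu e .refl) i
  rw [Subtype.ext_iff] at h0
  exact one_ne_zero (hui.symm.trans h0)

/-- A differential form of the density theorem: some combination of iterated derivations kills all
but one of finitely many elements independent over the constants. -/
lemma exists_mem_span_isIteratedDerivative (h : IsDeltaResidueField K Δ P E) [P.IsPrime]
    {ι : Type*} [Fintype ι] [DecidableEq ι] {e : ι → R}
    (he : LinearIndependent (derivationConstants (E '' Δ)) fun j => algebraMap R K (e j))
    (i : ι) : ∃ d ∉ P, ∃ w ∈ Submodule.span R {w | IsIteratedDerivative Δ e w},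
      ∀ j, algebraMap R K (w j) = Pi.single (M := fun _ => K) i (algebraMap R K d) j := by
  let T : Set (ι → K) := {y | ∃ w, IsIteratedDerivative Δ e w ∧ y = fun j => algebraMap R K (w j)}
  have htop : Submodule.span K T = ⊤ := by
    by_contra hne
    obtain ⟨f, hf, hle⟩ := Submodule.exists_le_ker_of_lt_top _ (lt_top_iff_ne_top.2 hne)
    refine hf ?_
    have hfs : ∀ y, f y = ∑ j, f (Pi.single j 1) * y j := fun y => by
      conv_lhs => rw [pi_eq_sum_univ' y]
      simp only [map_sum, map_smul, smul_eq_mul]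
      refine Finset.sum_congr rfl fun j _ => ?_
      rw [mul_comm]
    have hz := h.eq_zero_of_forall_isIteratedDerivative he (fun j => f (Pi.single j 1))
      fun w hw => by
        rw [← hfs fun j => algebraMap R K (w j)]
        exact hle (Submodule.subset_span ⟨w, hw, rfl⟩)
    refine LinearMap.ext fun y => ?_
    rw [hfs y]
    simp [fun j => congrFun hz j]
  have key : ∀ y ∈ Submodule.span K T, ∃ d ∉ P,
      ∃ w ∈ Submodule.span R {w | IsIteratedDerivative Δ e w},
        ∀ j, algebraMap R K (w j) = algebraMap R K d * y j := by
    intro y hy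
    have hone : (1 : R) ∉ P := (Ideal.ne_top_iff_one P).1 (Ideal.IsPrime.ne_top inferInstance)
    induction hy using Submodule.span_induction with
    | mem y hy =>
      obtain ⟨w, hw, rfl⟩ := hy
      exact ⟨1, hone, w, Submodule.subset_span hw, by simp⟩
    | zero => exact ⟨1, hone, 0, zero_mem _, by simp⟩
    | add y z _ _ hy hz =>
      obtain ⟨a, ha, v, hv, hav⟩ := hy
      obtain ⟨b, hb, w, hw, hbw⟩ := hz
      refine ⟨a * b, Ideal.IsPrime.mul_notMem inferInstance ha hb, b • v + a • w,
        add_mem (Submodule.smul_mem _ _ hv) (Submodule.smul_mem _ _ hw), fun j => ?_⟩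
      simp only [Pi.add_apply, Pi.smul_apply, smul_eq_mul, map_add, map_mul, hav, hbw]
      ring
    | smul c y _ hy =>
      obtain ⟨a, ha, v, hv, hav⟩ := hy
      obtain ⟨p, q, hq, hpq⟩ := h.exists_mul_eq c
      refine ⟨a * q, Ideal.IsPrime.mul_notMem inferInstance ha hq, p • v,
        Submodule.smul_mem _ _ hv, fun j => ?_⟩
      simp only [Pi.smul_apply, smul_eq_mul, map_mul, hav, ← hpq]
      ring
  obtain ⟨d, hd, w, hw, hdw⟩ := key (Pi.single i 1) (htop ▸ Submodule.mem_top)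
  refine ⟨d, hd, w, hw, fun j => ?_⟩
  rw [hdw]
  rcases eq_or_ne j i with rfl | hj
  · simp
  · simp [hj]

/-- Applying a combination of iterated derivations to a relation with constant coefficients. -/
lemma exists_mem_of_mem_span_isIteratedDerivative (h : IsDeltaResidueField K Δ P E)
    {Q : Ideal R} (hQ : IsDeltaIdeal k R Δ Q) {ι : Type*} [Fintype ι] {e : ι → R} {μ : ι → K}
    (hμ : ∀ j, μ j ∈ derivationConstants (E '' Δ)) {x : R} (hx : x ∈ Q)
    (hxe : algebraMap R K x = ∑ j, μ j * algebraMap R K (e j)) {w : ι → R}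
    (hw : w ∈ Submodule.span R {w | IsIteratedDerivative Δ e w}) :
    ∃ y ∈ Q, algebraMap R K y = ∑ j, μ j * algebraMap R K (w j) := by
  induction hw using Submodule.span_induction with
  | mem w hw =>
    induction hw with
    | refl => exact ⟨x, hx, hxe⟩
    | step δ hδ w _ ih =>
      obtain ⟨y, hy, hyw⟩ := ih
      refine ⟨δ y, hQ δ hδ y hy, ?_⟩
      rw [← h.extends_derivation δ hδ, hyw, map_sum]
      refine Finset.sum_congr rfl fun j _ => ?_
      rw [Derivation.leibniz, hμ j _ ⟨δ, hδ, rfl⟩, smul_zero, add_zero, smul_eq_mul,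
        h.extends_derivation δ hδ]
  | zero => exact ⟨0, zero_mem _, by simp⟩
  | add v w _ _ hv hw =>
    obtain ⟨y, hy, hyv⟩ := hv
    obtain ⟨z, hz, hzw⟩ := hw
    exact ⟨y + z, add_mem hy hz, by simp [hyv, hzw, mul_add, Finset.sum_add_distrib]⟩
  | smul c w _ hw =>
    obtain ⟨y, hy, hyw⟩ := hw
    refine ⟨c * y, Ideal.mul_mem_left _ _ hy, ?_⟩
    simp only [map_mul, hyw, Finset.mul_sum, Pi.smul_apply, smul_eq_mul]
    exact Finset.sum_congr rfl fun j _ => by ring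

lemma mem_of_algebraic_mul [IsScalarTower k R K] (h : IsDeltaResidueField K Δ P E)
    {Q : Ideal R} [Q.IsPrime] (hPQ : P ≤ Q) {μ : K} (hμ : IsAlgebraic k μ) (hμ0 : μ ≠ 0)
    {d y : R} (hy : y ∈ Q) (hdy : algebraMap R K d * μ = algebraMap R K y) : d ∈ Q := by
  set p := minpoly k μ
  have hp0 : p.coeff 0 ≠ 0 := minpoly.coeff_zero_ne_zero hμ.isIntegral hμ0
  have hQ : homogenizedEval p y d ∈ Q := by
    refine hPQ ((h.algebraMap_eq_zero _).1 ?_)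
    refine (map_homogenizedEval (IsScalarTower.toAlgHom k R K) p hdy).trans ?_
    rw [minpoly.aeval, mul_zero]
  have hy0 : Ideal.Quotient.mkₐ k Q d * 0 = Ideal.Quotient.mkₐ k Q y := by
    rw [mul_zero]
    exact (Ideal.Quotient.eq_zero_iff_mem.2 hy).symm
  have h1 := map_homogenizedEval (Ideal.Quotient.mkₐ k Q) p hy0
  rw [show Ideal.Quotient.mkₐ k Q (homogenizedEval p y d) = 0 from
    Ideal.Quotient.eq_zero_iff_mem.2 hQ, ← coeff_zero_eq_aeval_zero'] at h1
  have h2 : algebraMap k (R ⧸ Q) (p.coeff 0) ≠ 0 := by simpa using hp0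
  exact Ideal.Quotient.eq_zero_iff_mem.1
    (eq_zero_of_pow_eq_zero ((mul_eq_zero.1 h1.symm).resolve_right h2))

end IsDeltaResidueField

section Primitive

open Cardinal

variable {k R : Type u} [Field k] [CommRing R] [Algebra k R]
  {Δ : Set (Derivation k R R)}

lemma Cardinal.mk_finset_lt {α : Type u} {c : Cardinal.{u}} (hc : ℵ₀ ≤ c) (hα : #α < c) :
    #(Finset α) < c := by
  cases finite_or_infinite α
  · exact (lt_aleph0_of_finite _).trans_le hc
  · rwa [mk_finset_of_infinite]

lemma IsDeltaPrimitive.isDeltaRational (hrank : Module.rank k R < #k) {P : Ideal R}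
    (hP : P.IsPrime) (hPΔ : IsDeltaIdeal k R Δ P) (h : IsDeltaPrimitive k R Δ P) :
    IsDeltaRational k R Δ P hP := by
  obtain ⟨M, hM, hMP⟩ := h
  obtain ⟨E, hE⟩ := exists_isDeltaResidueField hPΔ
  intro a b hb hab
  refine hE.isAlgebraic_of_mem_constants (isAlgebraic_quotient_of_isMaximal hrank M) hMP ?_
  refine (hE.mem_constants_iff hb ?_).2 hab
  exact div_mul_cancel₀ _ (mt (hE.algebraMap_eq_zero b).1 hb)

lemma IsDeltaRational.isDeltaPrimitive [CharZero k] (hrank : Module.rank k R < #k) {P : Ideal R}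
    (hP : P.IsPrime) (hPΔ : IsDeltaIdeal k R Δ P) (h : IsDeltaRational k R Δ P hP) :
    IsDeltaPrimitive k R Δ P := by
  classical
  obtain ⟨E, hE⟩ := exists_isDeltaResidueField hPΔ
  let K := FractionRing (R ⧸ P)
  let C := derivationConstants (E '' Δ)
  have halg : ∀ z ∈ C, IsAlgebraic k z := by
    intro z hz
    obtain ⟨a, b, hb, hz'⟩ := hE.exists_mul_eq z
    have := h a b hb ((hE.mem_constants_iff hb hz').1 hz)
    rwa [show z = algebraMap R K a / algebraMap R K b from
      eq_div_of_mul_eq (mt (hE.algebraMap_eq_zero b).1 hb) hz']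
  have hinf : ℵ₀ ≤ #k := by
    have : Infinite k := Infinite.of_injective _ (Nat.cast_injective (R := k))
    exact aleph0_le_mk k
  let B := Module.Basis.ofVectorSpace k R
  obtain ⟨κ, a, ha, hspan, hli⟩ := exists_linearIndependent' C fun j => algebraMap R K (B j)
  have hκ : #κ < #k :=
    ((mk_le_of_injective ha).trans_eq B.mk_eq_rank'').trans_lt hrank
  have hli' (F : Finset κ) :
      LinearIndependent C fun j : F => algebraMap R K (B (a j)) :=
    hli.comp _ Subtype.val_injective
  choose d hd w hw hdw using fun (F : Finset κ) (i : F) =>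
    hE.exists_mem_span_isIteratedDerivative (hli' F) i
  let D : Finset κ → R := fun F => ∏ i, d F i
  obtain ⟨M, hM, hPM, hDM⟩ := exists_isMaximal_disjoint hrank P (Set.range D)
    (mk_range_le.trans_lt (Cardinal.mk_finset_lt hinf hκ)) (by
      rintro _ ⟨F, rfl⟩ hF
      obtain ⟨i, _, hi⟩ := (hP.prod_mem_iff).1 hF
      exact hd F i hi)
  refine ⟨M, hM, le_antisymm (fun x hx => ?_) (hPΔ.le_deltaCore hPM)⟩
  by_contra hxP
  set Q := deltaCore k R Δ M
  have hQ : Q.IsPrime := isPrime_deltaCore hM.isPrime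
  have hxspan : algebraMap R K x ∈
      Submodule.span C (Set.range ((fun j => algebraMap R K (B j)) ∘ a)) := by
    rw [hspan, ← B.linearCombination_repr x, Finsupp.linearCombination_apply, Finsupp.sum, map_sum]
    refine sum_mem fun i _ => ?_
    rw [Algebra.smul_def, map_mul, ← IsScalarTower.algebraMap_apply,
      IsScalarTower.algebraMap_apply k C K, ← Algebra.smul_def]
    exact Submodule.smul_mem _ _ (Submodule.subset_span ⟨i, rfl⟩)
  obtain ⟨c, hc⟩ := (Finsupp.mem_span_range_iff_exists_finsupp).1 hxspan
  have hxe : algebraMap R K x = ∑ j : c.support, (c j : K) * algebraMap R K (B (a j)) := by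
    rw [← hc, Finsupp.sum, ← Finset.sum_coe_sort]
    rfl
  have hne : c.support.Nonempty := by
    rw [Finset.nonempty_iff_ne_empty]
    intro h0
    rw [Finsupp.support_eq_empty] at h0
    rw [h0, Finsupp.sum_zero_index] at hc
    exact hxP ((hE.algebraMap_eq_zero x).1 hc.symm)
  obtain ⟨i, hi⟩ := hne
  obtain ⟨y, hy, hyw⟩ := hE.exists_mem_of_mem_span_isIteratedDerivative (isDeltaIdeal_deltaCore M)
    (fun j : c.support => (c j).2) hx hxe (hw c.support ⟨i, hi⟩)
  have hdy : algebraMap R K (d c.support ⟨i, hi⟩) * (c i : K) = algebraMap R K y := by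
    rw [hyw, Finset.sum_eq_single ⟨i, hi⟩]
    · rw [hdw, Pi.single_eq_same, mul_comm]
    · intro j _ hj
      rw [hdw, Pi.single_eq_of_ne hj, mul_zero]
    · exact fun h => absurd (Finset.mem_univ _) h
  have hmem : d c.support ⟨i, hi⟩ ∈ Q :=
    hE.mem_of_algebraic_mul (hPΔ.le_deltaCore hPM) (halg _ (c i).2)
      (by simpa using Finsupp.mem_support_iff.1 hi) hy hdy
  exact hDM _ ⟨c.support, rfl⟩ (Ideal.mem_of_dvd _ (Finset.dvd_prod_of_mem _ (Finset.mem_univ _))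
    (deltaCore_le M hmem))

end Primitive

section Topology

open Cardinal

variable {k R : Type u} [Field k] [CommRing R] [Algebra k R]
  {Δ : Set (Derivation k R R)}

lemma isLocallyClosed_singleton_deltaSpec_iff (P : PrimeSpectrum R)
    (hP : IsDeltaIdeal k R Δ P.asIdeal) :
    IsLocallyClosed ({⟨P, hP⟩} : Set (DeltaSpec k R Δ)) ↔
      ∃ g ∉ P.asIdeal, ∀ Q : Ideal R, Q.IsPrime → IsDeltaIdeal k R Δ Q → P.asIdeal ≤ Q →
        g ∉ Q → Q = P.asIdeal := by
  constructor
  · rintro ⟨U, Z, ⟨U', hU', rfl⟩, hZ, hUZ⟩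
    obtain ⟨Z', hZ', rfl⟩ := isClosed_induced_iff.1 hZ
    obtain ⟨hPU, hPZ⟩ := hUZ.subset rfl
    obtain ⟨_, ⟨g, rfl⟩, hPg, hgU⟩ :=
      PrimeSpectrum.isTopologicalBasis_basic_opens.exists_subset_of_mem_open hPU hU'
    obtain ⟨s, rfl⟩ := (PrimeSpectrum.isClosed_iff_zeroLocus _).1 hZ'
    refine ⟨g, hPg, fun Q hQ hQΔ hPQ hgQ => ?_⟩
    have : (⟨⟨Q, hQ⟩, hQΔ⟩ : DeltaSpec k R Δ) ∈ ({⟨P, hP⟩} : Set (DeltaSpec k R Δ)) := by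
      rw [hUZ]
      exact ⟨hgU hgQ, fun x hx => hPQ (hPZ hx)⟩
    exact congrArg (fun q : DeltaSpec k R Δ => q.1.asIdeal) this
  · rintro ⟨g, hg, h⟩
    refine ⟨Subtype.val ⁻¹' PrimeSpectrum.basicOpen g,
      Subtype.val ⁻¹' PrimeSpectrum.zeroLocus P.asIdeal,
      (PrimeSpectrum.basicOpen g).isOpen.preimage continuous_subtype_val,
      (PrimeSpectrum.isClosed_zeroLocus _).preimage continuous_subtype_val, ?_⟩
    ext Q
    constructor
    · rintro rfl
      exact ⟨hg, le_refl P.asIdeal⟩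
    · rintro ⟨h1, h2⟩
      exact Subtype.ext (PrimeSpectrum.ext (h _ Q.1.isPrime Q.2 h2 h1))

lemma continuous_deltaCore [CharZero k] : Continuous fun Q : PrimeSpectrum R =>
    (⟨⟨deltaCore k R Δ Q.asIdeal, isPrime_deltaCore Q.isPrime⟩, isDeltaIdeal_deltaCore _⟩ :
      DeltaSpec k R Δ) := by
  refine Continuous.subtype_mk (continuous_iff_isClosed.2 fun Z hZ => ?_) _
  obtain ⟨s, rfl⟩ := (PrimeSpectrum.isClosed_iff_zeroLocus _).1 hZ
  let J : Ideal R := sInf {I | IsDeltaIdeal k R Δ I ∧ s ⊆ I}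
  have hJ : IsDeltaIdeal k R Δ J := fun δ hδ x hx =>
    Submodule.mem_sInf.2 fun I hI => hI.1 δ hδ x (Submodule.mem_sInf.1 hx I hI)
  have hsJ : s ⊆ J := fun x hx => Submodule.mem_sInf.2 fun I hI => hI.2 hx
  convert! PrimeSpectrum.isClosed_zeroLocus (J : Set R) using 1
  ext Q
  exact ⟨fun h => (show J ≤ _ from sInf_le ⟨isDeltaIdeal_deltaCore _, h⟩).trans (deltaCore_le _),
    fun h => hsJ.trans (hJ.le_deltaCore h)⟩

/-- A prime `Δ`-ideal which is locally closed in `Δ`-spec `R` is the core of maximal ideals avoiding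
a given element. -/
lemma exists_isMaximal_deltaCore_eq [CharZero k] (hrank : Module.rank k R < #k)
    {P : Ideal R} (hP : P.IsPrime)
    (hPΔ : IsDeltaIdeal k R Δ P) {g : R} (hg : g ∉ P)
    (h : ∀ Q : Ideal R, Q.IsPrime → IsDeltaIdeal k R Δ Q → P ≤ Q → g ∉ Q → Q = P)
    {f : R} (hf : f ∉ P) : ∃ M : Ideal R, M.IsMaximal ∧ f ∉ M ∧ deltaCore k R Δ M = P := by
  have hinf : Infinite k := Infinite.of_injective _ (Nat.cast_injective (R := k))
  obtain ⟨M, hM, hPM, hMS⟩ := exists_isMaximal_disjoint hrank P {f * g}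
    (by rw [mk_singleton]; exact one_lt_aleph0.trans_le (aleph0_le_mk k))
    (by rintro _ rfl; exact hP.mul_notMem hf hg)
  have hfg := hMS _ rfl
  refine ⟨M, hM, fun hfM => hfg (Ideal.mul_mem_right _ _ hfM),
    h _ (isPrime_deltaCore hM.isPrime) (isDeltaIdeal_deltaCore M) (hPΔ.le_deltaCore hPM)
      fun hgM => hfg (Ideal.mul_mem_left _ _ (deltaCore_le M hgM))⟩

lemma IsDeltaPrimitive.isPrime [CharZero k] {P : Ideal R} (h : IsDeltaPrimitive k R Δ P) :
    P.IsPrime := by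
  obtain ⟨M, hM, rfl⟩ := h
  exact isPrime_deltaCore hM.isPrime

lemma IsDeltaPrimitive.isDeltaIdeal {P : Ideal R} (h : IsDeltaPrimitive k R Δ P) :
    IsDeltaIdeal k R Δ P := by
  obtain ⟨M, -, rfl⟩ := h
  exact isDeltaIdeal_deltaCore M

/-- Under the cardinality hypothesis, the `Δ`-Dixmier–Moeglin equivalence only requires
`Δ`-primitive ideals to be locally closed. -/
lemma deltaDME_iff_isLocallyClosed [CharZero k] (hrank : Module.rank k R < #k) :
    DeltaDME k R Δ ↔ ∀ (P : PrimeSpectrum R) (hP : IsDeltaIdeal k R Δ P.asIdeal),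
      IsDeltaPrimitive k R Δ P.asIdeal → IsLocallyClosed ({⟨P, hP⟩} : Set (DeltaSpec k R Δ)) := by
  refine ⟨fun h P hP hprim => (h P hP).1.2 hprim, fun h P hP => ⟨⟨fun hlc => ?_, h P hP⟩,
    fun hprim => hprim.isDeltaRational hrank P.isPrime hP,
    fun hrat => hrat.isDeltaPrimitive hrank P.isPrime hP⟩⟩
  obtain ⟨g, hg, hgP⟩ := (isLocallyClosed_singleton_deltaSpec_iff P hP).1 hlc
  obtain ⟨M, hM, -, hMP⟩ := exists_isMaximal_deltaCore_eq hrank P.isPrime hP hg hgP hg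
  exact ⟨M, hM, hMP⟩

lemma isLocallyClosed_singleton_deltaSpec_iff_core [CharZero k] (P : PrimeSpectrum R)
    (hP : IsDeltaIdeal k R Δ P.asIdeal) :
    IsLocallyClosed ({⟨P, hP⟩} : Set (DeltaSpec k R Δ)) ↔
      IsLocallyClosed {Q : PrimeSpectrum R | deltaCore k R Δ Q.asIdeal = P.asIdeal} := by
  constructor
  · intro h
    convert! h.preimage continuous_deltaCore using 1
    ext Q
    simp [Subtype.ext_iff, PrimeSpectrum.ext_iff]
  · intro h
    convert! h.preimage (continuous_subtype_val (p := fun Q : PrimeSpectrum R =>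
      IsDeltaIdeal k R Δ Q.asIdeal)) using 1
    ext Q
    simp [Subtype.ext_iff, PrimeSpectrum.ext_iff, Q.2.deltaCore_eq]

end Topology

section Maximal

variable {k R : Type u} [Field k] [CharZero k] [CommRing R] [Algebra k R]
  {Δ : Set (Derivation k R R)}

open Cardinal

lemma IsDeltaPrimitive.isLocallyClosed_maximalCore
    (hrank : Module.rank k R < #k) {P : Ideal R} (hP : IsDeltaPrimitive k R Δ P)
    (h : IsLocallyClosed {Q : PrimeSpectrum R | deltaCore k R Δ Q.asIdeal = P}) :
    IsLocallyClosed {M : MaximalSpectrum R | deltaCore k R Δ M.asIdeal = P} ∧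
      closure {M : MaximalSpectrum R | deltaCore k R Δ M.asIdeal = P} =
        {M : MaximalSpectrum R | P ≤ M.asIdeal} := by
  have hlc : IsLocallyClosed {M : MaximalSpectrum R | deltaCore k R Δ M.asIdeal = P} :=
    (h.preimage MaximalSpectrum.toPrimeSpectrum_continuous :)
  refine ⟨hlc, ?_⟩
  obtain ⟨g, hg, hgP⟩ := (isLocallyClosed_singleton_deltaSpec_iff ⟨P, hP.isPrime⟩ hP.isDeltaIdeal).1
      ((isLocallyClosed_singleton_deltaSpec_iff_core ⟨P, hP.isPrime⟩ hP.isDeltaIdeal).2 h)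
  refine subset_antisymm (closure_minimal (fun M hM => ?_) ?_) fun M hM => ?_
  · exact (show deltaCore k R Δ M.asIdeal = P from hM) ▸ deltaCore_le M.asIdeal
  · exact (PrimeSpectrum.isClosed_zeroLocus (P : Set R)).preimage
      MaximalSpectrum.toPrimeSpectrum_continuous
  · refine mem_closure_iff.2 ?_
    rintro _ ⟨U, hU, rfl⟩ hMU
    replace hMU : M.toPrimeSpectrum ∈ U := hMU
    obtain ⟨_, ⟨f, rfl⟩, hMf, hfU⟩ :=
      PrimeSpectrum.isTopologicalBasis_basic_opens.exists_subset_of_mem_open hMU hU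
    obtain ⟨N, hN, hfN, hNP⟩ := exists_isMaximal_deltaCore_eq hrank hP.isPrime hP.isDeltaIdeal
      hg hgP (fun hfP => hMf (hM hfP))
    have hNU : (⟨N, hN.isPrime⟩ : PrimeSpectrum R) ∈ U := hfU hfN
    exact ⟨⟨N, hN⟩, hNU, hNP⟩

lemma IsDeltaPrimitive.isLocallyClosed_singleton
    (hrank : Module.rank k R < #k) {P : Ideal R} (hP : IsDeltaPrimitive k R Δ P)
    (h : IsLocallyClosed {M : MaximalSpectrum R | deltaCore k R Δ M.asIdeal = P} ∧
      closure {M : MaximalSpectrum R | deltaCore k R Δ M.asIdeal = P} =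
        {M : MaximalSpectrum R | P ≤ M.asIdeal}) :
    IsLocallyClosed ({⟨⟨P, hP.isPrime⟩, hP.isDeltaIdeal⟩} : Set (DeltaSpec k R Δ)) := by
  obtain ⟨⟨U, Z, ⟨U', hU', rfl⟩, hZ, hUZ⟩, hcl⟩ := h
  obtain ⟨M, hM, hMP⟩ := id hP
  have hMC : (⟨M, hM⟩ : MaximalSpectrum R) ∈
      {N : MaximalSpectrum R | deltaCore k R Δ N.asIdeal = P} := hMP
  rw [hUZ] at hMC
  have hMU : (⟨M, hM.isPrime⟩ : PrimeSpectrum R) ∈ U' := hMC.1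
  obtain ⟨_, ⟨g, rfl⟩, hMg, hgU⟩ :=
    PrimeSpectrum.isTopologicalBasis_basic_opens.exists_subset_of_mem_open hMU hU'
  have hVZ : {N : MaximalSpectrum R | P ≤ N.asIdeal} ⊆ Z := by
    rw [← hcl, hUZ]
    exact closure_minimal Set.inter_subset_right hZ
  refine (isLocallyClosed_singleton_deltaSpec_iff ⟨P, hP.isPrime⟩ hP.isDeltaIdeal).2
    ⟨g, fun hg => hMg (hMP.ge.trans (deltaCore_le M) hg), fun Q hQ hQΔ hPQ hgQ => ?_⟩
  have hinf : Infinite k := Infinite.of_injective _ (Nat.cast_injective (R := k))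
  obtain ⟨N, hN, hQN, hgN⟩ := exists_isMaximal_disjoint hrank Q {g}
    (by
      rw [Cardinal.mk_singleton]
      exact Cardinal.one_lt_aleph0.trans_le (Cardinal.aleph0_le_mk k))
    (by rintro _ rfl; exact hgQ)
  have hNC : (⟨N, hN⟩ : MaximalSpectrum R) ∈
      {N : MaximalSpectrum R | deltaCore k R Δ N.asIdeal = P} := by
    rw [hUZ]
    have hgN' : (⟨N, hN.isPrime⟩ : PrimeSpectrum R) ∈ U' := hgU (hgN g rfl)
    exact ⟨hgN', hVZ (show P ≤ N from hPQ.trans hQN)⟩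
  replace hNC : deltaCore k R Δ N = P := hNC
  exact le_antisymm ((hQΔ.le_deltaCore hQN).trans hNC.le) hPQ

end Maximal

/-- The `Δ`-Dixmier–Moeglin equivalence is equivalent to all prime differential cores of
`Δ`-primitive ideals being locally closed in `Spec R`, and to all differential cores of
`Δ`-primitive ideals being locally closed in `Max R` with closure the full vanishing set. -/
theorem deltaDME_iff_cores_locallyClosed (k R : Type u) [Field k] [CharZero k]
    [CommRing R] [Algebra k R] [IsNoetherianRing R]
    (hrank : Module.rank k R < Cardinal.mk k)
    (Δ : Set (Derivation k R R)) (hΔ : Cardinal.mk Δ < Cardinal.mk k) :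
    List.TFAE [
      DeltaDME k R Δ,
      ∀ P : Ideal R, IsDeltaPrimitive k R Δ P →
        IsLocallyClosed {Q : PrimeSpectrum R | deltaCore k R Δ Q.asIdeal = P},
      ∀ P : Ideal R, IsDeltaPrimitive k R Δ P →
        IsLocallyClosed {M : MaximalSpectrum R | deltaCore k R Δ M.asIdeal = P} ∧
        closure {M : MaximalSpectrum R | deltaCore k R Δ M.asIdeal = P} =
          {M : MaximalSpectrum R | P ≤ M.asIdeal}] := by
  rw [deltaDME_iff_isLocallyClosed hrank]
  tfae_have 1 → 2 := fun h P hP =>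
    (isLocallyClosed_singleton_deltaSpec_iff_core ⟨P, hP.isPrime⟩ hP.isDeltaIdeal).1
      (h ⟨P, hP.isPrime⟩ hP.isDeltaIdeal hP)
  tfae_have 2 → 3 := fun h P hP => hP.isLocallyClosed_maximalCore hrank (h P hP)
  tfae_have 3 → 1 := fun h P _ hP => hP.isLocallyClosed_singleton hrank (h P.asIdeal hP)
  tfae_finish
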